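/- arXiv:1802.01244 — 9 statements merged into one kernel-verified Lean document; each statement's English description precedes it below -/
import Mathlib

section
/- Let n ≥ 0 and k ≥ 1 be integers. Then ∑_{m=0}^{n} ∑_{l=k}^{m+k} (C(n,m)/C(m+k,m)) · S₂(l,k) · S₂(m+k,l) · B_{n−m}^{(k)} = ∑_{m=0}^{n} S₂(n,m) · ∫_{(0,1)^k} (u₁+⋯+u_k)^m du₁⋯du_k, where the integral on the right-hand side is the m-th moment E[(U₁+⋯+U_k)^m] of a sum of k independent uniform random variables on (0,1). -/
open MeasureTheory Finset

/-- Stirling numbers of the second kind: `S₂(n,k) = (1/k!) ∑_{l=0}^k (−1)^{k−l} C(k,l) lⁿ`. -/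
noncomputable def S2 (n k : ℕ) : ℝ :=
  (Nat.factorial k : ℝ)⁻¹ *
    ∑ l ∈ Finset.range (k + 1), (-1 : ℝ) ^ (k - l) * (k.choose l) * (l : ℝ) ^ n

/-- Higher-order Bernoulli numbers: the `k`-fold binomial convolution of the Bernoulli
numbers (with `B₁ = −1/2`). -/
noncomputable def Bhigh (k n : ℕ) : ℝ :=
  ∑ j ∈ Finset.Nat.antidiagonalTuple k n,
    (Nat.multinomial Finset.univ j : ℝ) * ∏ i, (bernoulli (j i) : ℝ)

open PowerSeries in
theorem coeff_mk_div_factorial_pow (a : ℕ → ℝ) (k n : ℕ) :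
    ∑ j ∈ piAntidiag (univ : Finset (Fin k)) n, (Nat.multinomial univ j : ℝ) * ∏ i, a (j i)
      = n.factorial * coeff n ((mk fun i => a i / i.factorial) ^ k) := by
  have hprod : (mk fun i => a i / i.factorial) ^ k
      = ∏ _i : Fin k, (mk fun i => a i / i.factorial) := by simp
  rw [hprod, coeff_prod, mul_sum]
  refine sum_nbij' (fun j => Finsupp.equivFunOnFinite.symm j) (fun j => j) ?_ ?_ ?_ ?_ ?_
  · intro j hj
    simpa [mem_finsuppAntidiag] using hj
  · intro j hj
    simpa [mem_finsuppAntidiag] using hj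
  · intro j _
    rfl
  · intro j _
    ext
    rfl
  · intro j hj
    have hsum : ∑ i, j i = n := by simpa using hj
    have hspec : (∏ i, ((j i).factorial : ℝ)) * Nat.multinomial univ j = n.factorial := by
      exact_mod_cast hsum ▸ Nat.multinomial_spec univ j
    have hne : ∏ i, ((j i).factorial : ℝ) ≠ 0 :=
      prod_ne_zero_iff.mpr fun i _ => by exact_mod_cast (j i).factorial_ne_zero
    simp only [coeff_mk, Finsupp.equivFunOnFinite_symm_apply_apply, prod_div_distrib, ← hspec]
    field_simp

open PowerSeries in
theorem Bhigh_eq_coeff (k n : ℕ) :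
    Bhigh k n = n.factorial * coeff n (bernoulliPowerSeries ℝ ^ k) := by
  have h : bernoulliPowerSeries ℝ = mk fun i => (bernoulli i : ℝ) / i.factorial := by
    ext i
    simp [bernoulliPowerSeries]
  rw [h, ← coeff_mk_div_factorial_pow, piAntidiag_univ_fin_eq_antidiagonalTuple]
  rfl

/-- The power series `(e^t - 1) / t`. -/
noncomputable def expSubOneDivX : PowerSeries ℝ :=
  PowerSeries.mk fun i => (1 / (i + 1 : ℝ)) / i.factorial

open PowerSeries in
theorem X_mul_expSubOneDivX : X * expSubOneDivX = exp ℝ - 1 := by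
  ext n
  cases n with
  | zero => simp
  | succ n =>
    rw [coeff_succ_X_mul]
    simp [expSubOneDivX, coeff_one, Nat.factorial_succ, div_eq_mul_inv, mul_comm]

open PowerSeries in
theorem bernoulliPowerSeries_mul_expSubOneDivX :
    bernoulliPowerSeries ℝ * expSubOneDivX = 1 := by
  have h := bernoulliPowerSeries_mul_exp_sub_one ℝ
  rw [← X_mul_expSubOneDivX, mul_left_comm] at h
  exact mul_left_cancel₀ X_ne_zero (h.trans (mul_one X).symm)

open PowerSeries in
theorem S2_eq_coeff (n k : ℕ) :
    S2 n k = n.factorial / k.factorial * coeff n ((exp ℝ - 1) ^ k) := by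
  have hn : (n.factorial : ℝ) ≠ 0 := by exact_mod_cast n.factorial_ne_zero
  rw [S2, sub_eq_add_neg, add_pow, map_sum, div_eq_inv_mul, mul_assoc,
    mul_sum (a := (n.factorial : ℝ))]
  congr 1
  refine sum_congr rfl fun l _ => ?_
  have hC : ((-1 : PowerSeries ℝ) ^ (k - l) * (k.choose l : PowerSeries ℝ))
      = C ((-1 : ℝ) ^ (k - l) * (k.choose l : ℝ)) := by simp
  rw [mul_assoc (exp ℝ ^ l), hC, coeff_mul_C, exp_pow_eq_rescale_exp, coeff_rescale, coeff_exp]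
  simp only [map_div₀, map_one, map_natCast]
  field_simp

open PowerSeries in
theorem coeff_subst_eq_sum_range {b : PowerSeries ℝ} (hb : constantCoeff b = 0)
    (f : PowerSeries ℝ) {n N : ℕ} (hN : n < N) :
    coeff n (f.subst b) = ∑ d ∈ range N, coeff d f * coeff n (b ^ d) := by
  rw [coeff_subst' (HasSubst.of_constantCoeff_zero' hb)]
  simp only [smul_eq_mul]
  refine finsum_eq_sum_of_support_subset _ fun d hd => ?_
  by_contra hd'
  refine hd ?_
  have hnd : n < d := by
    simp only [coe_range, Set.mem_Iio, not_lt] at hd'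
    lia
  have hdvd : X ^ d ∣ b ^ d := pow_dvd_pow_of_dvd (X_dvd_iff.mpr hb) d
  simp only [X_pow_dvd_iff.mp hdvd n hnd, mul_zero]

open PowerSeries in
theorem setIntegral_sum_pow_eq_coeff (k m : ℕ) :
    ∫ u in Set.univ.pi (fun _ : Fin k => Set.Ioo (0 : ℝ) 1), (∑ i, u i) ^ m
      = m.factorial * coeff m (expSubOneDivX ^ k) := by
  have hunit (j : ℕ) : ∫ x in Set.Ioo (0 : ℝ) 1, x ^ j = 1 / (j + 1 : ℝ) := by
    rw [← integral_Ioc_eq_integral_Ioo, ← intervalIntegral.integral_of_le zero_le_one,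
      integral_pow]
    simp
  rw [expSubOneDivX, ← coeff_mk_div_factorial_pow (fun i => 1 / (i + 1 : ℝ)), volume_pi,
    Measure.restrict_pi_pi]
  simp only [sum_pow_eq_sum_piAntidiag]
  rw [integral_finsetSum]
  · refine sum_congr rfl fun j _ => ?_
    rw [integral_const_mul, integral_fintype_prod_eq_prod (fun i x => x ^ j i)]
    simp only [hunit]
  · intro j _
    refine Integrable.const_mul (Integrable.fintype_prod (f := fun i x => x ^ j i) fun i => ?_) _
    exact ((continuous_pow (j i)).integrableOn_Icc (a := (0 : ℝ)) (b := 1)).mono_set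
      Set.Ioo_subset_Icc_self

open PowerSeries in
theorem sum_Icc_S2_mul_S2 (k N : ℕ) :
    ∑ l ∈ Icc k N, S2 l k * S2 N l
      = N.factorial / k.factorial
        * coeff N (((exp ℝ - 1) ^ k).subst (exp ℝ - 1 : PowerSeries ℝ)) := by
  have h0 : constantCoeff (exp ℝ - 1) = 0 := by simp
  rw [coeff_subst_eq_sum_range h0 _ (Nat.lt_succ_self N), mul_sum]
  refine sum_subset_zero_on_sdiff (fun l hl => ?_) (fun l hl => ?_) (fun l _ => ?_)
  · simp only [mem_Icc, mem_range] at hl ⊢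
    lia
  · have hlk : l < k := by
      simp only [mem_Icc, mem_range, mem_sdiff] at hl
      lia
    have hdvd : X ^ k ∣ (exp ℝ - 1) ^ k := pow_dvd_pow_of_dvd (X_dvd_iff.mpr h0) k
    rw [X_pow_dvd_iff.mp hdvd l hlk]
    simp
  · have hl : (l.factorial : ℝ) ≠ 0 := by exact_mod_cast l.factorial_ne_zero
    rw [S2_eq_coeff, S2_eq_coeff]
    field_simp

open PowerSeries in
theorem subst_exp_sub_one_pow_self (k : ℕ) :
    ((exp ℝ - 1) ^ k).subst (exp ℝ - 1 : PowerSeries ℝ)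
      = X ^ k * (expSubOneDivX ^ k
        * (expSubOneDivX ^ k).subst (exp ℝ - 1 : PowerSeries ℝ)) := by
  have hs : HasSubst (exp ℝ - 1 : PowerSeries ℝ) := .of_constantCoeff_zero' (by simp)
  conv_lhs => rw [← X_mul_expSubOneDivX, mul_pow, X_mul_expSubOneDivX]
  rw [subst_mul hs, subst_pow hs, subst_X hs, ← mul_assoc, ← mul_pow, X_mul_expSubOneDivX]

/-- For `n ≥ 0`, `k ≥ 1`:
`∑_{m=0}^n ∑_{l=k}^{m+k} (C(n,m)/C(m+k,m)) S₂(l,k) S₂(m+k,l) B_{n−m}^{(k)}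
  = ∑_{m=0}^n S₂(n,m) E[(U₁+⋯+U_k)^m]`. -/
theorem stmt0 (n k : ℕ) (hk : 1 ≤ k) :
    ∑ m ∈ Finset.range (n + 1), ∑ l ∈ Finset.Icc k (m + k),
        ((n.choose m : ℝ) / ((m + k).choose m : ℝ)) * S2 l k * S2 (m + k) l * Bhigh k (n - m)
      = ∑ m ∈ Finset.range (n + 1), S2 n m *
          ∫ u in Set.univ.pi (fun _ : Fin k => Set.Ioo (0 : ℝ) 1), (∑ i, u i) ^ m := by
  have hn : (n.factorial : ℝ) ≠ 0 := by exact_mod_cast n.factorial_ne_zero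
  set T := (expSubOneDivX ^ k).subst (PowerSeries.exp ℝ - 1 : PowerSeries ℝ) with hT
  have hT_eq : T = expSubOneDivX ^ k * T * bernoulliPowerSeries ℝ ^ k := by
    rw [mul_right_comm, ← mul_pow, mul_comm expSubOneDivX,
      bernoulliPowerSeries_mul_expSubOneDivX, one_pow, one_mul]
  trans (n.factorial : ℝ) * PowerSeries.coeff n T
  · rw [hT_eq, PowerSeries.coeff_mul, Nat.sum_antidiagonal_eq_sum_range_succ_mk, mul_sum]
    refine sum_congr rfl fun m hm => ?_
    have hmn : m ≤ n := Nat.lt_succ_iff.mp (mem_range.mp hm)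
    simp only [mul_assoc]
    rw [← mul_sum]
    simp only [← mul_assoc]
    rw [← sum_mul, sum_Icc_S2_mul_S2, subst_exp_sub_one_pow_self, ← hT,
      PowerSeries.coeff_X_pow_mul, Bhigh_eq_coeff, Nat.cast_choose ℝ hmn,
      Nat.cast_choose ℝ (Nat.le_add_right m k), Nat.add_sub_cancel_left]
    have hf (i : ℕ) : (i.factorial : ℝ) ≠ 0 := by exact_mod_cast i.factorial_ne_zero
    have := hf m
    have := hf k
    have := hf (n - m)
    have := hf (m + k)
    field_simp
  · rw [hT, coeff_subst_eq_sum_range (by simp) _ (Nat.lt_succ_self n), mul_sum]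
    refine sum_congr rfl fun m _ => ?_
    have hm : (m.factorial : ℝ) ≠ 0 := by exact_mod_cast m.factorial_ne_zero
    rw [setIntegral_sum_pow_eq_coeff, S2_eq_coeff]
    field_simp
end

section
/- Let n ≥ 0 and k ≥ 1 be integers. Then ∑_{m=0}^{n} ∑_{l=k}^{m+k} (C(n,m)/C(m+k,m)) · S₂(l,k) · S₂(m+k,l) · B_{n−m}^{(k)} = ∑_{m=0}^{n} S₂(n,m) · ∑_{l₁+⋯+l_k = m+k, each l_i ≥ 1} m!/(l₁!·l₂!⋯l_k!). -/
open MeasureTheory Finset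

open PowerSeries in
/-- `S2 n k` is `n! / k!` times the `n`-th coefficient of `(eᵗ - 1)ᵏ`. -/
lemma coeff_exp_sub_one_pow (n k : ℕ) :
    coeff n ((exp ℝ - 1) ^ k) = (k.factorial : ℝ) / n.factorial * S2 n k := by
  have hk : (k.factorial : ℝ) ≠ 0 := by positivity
  rw [sub_eq_add_neg, add_pow, map_sum, S2, div_mul_eq_mul_div, mul_inv_cancel_left₀ hk,
    Finset.sum_div]
  refine Finset.sum_congr rfl fun l _ => ?_
  have h : (exp ℝ ^ l * (-1) ^ (k - l) * (k.choose l : ℝ⟦X⟧)) =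
      C ((-1) ^ (k - l) * (k.choose l : ℝ)) * exp ℝ ^ l := by
    simp only [map_mul, map_pow, map_neg, map_one, map_natCast]
    ring
  rw [h, coeff_C_mul, exp_pow_eq_rescale_exp, coeff_rescale, coeff_exp]
  simp
  ring

open PowerSeries in
lemma coeff_pow_eq_sum_antidiagonalTuple {R : Type*} [CommSemiring R] (f : R⟦X⟧) (k n : ℕ) :
    coeff n (f ^ k) = ∑ j ∈ Finset.Nat.antidiagonalTuple k n, ∏ i, coeff (j i) f := by
  have h := coeff_prod (fun _ : Fin k => f) n Finset.univ
  rw [Finset.prod_const, Finset.card_univ, Fintype.card_fin] at h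
  rw [h]
  refine Finset.sum_equiv Finsupp.equivFunOnFinite (fun l => ?_) fun l _ => rfl
  simp [Finset.Nat.mem_antidiagonalTuple]

open PowerSeries in
/-- `Bhigh k n` is `n!` times the `n`-th coefficient of `(t / (eᵗ - 1))ᵏ`. -/
lemma coeff_bernoulliPowerSeries_pow (n k : ℕ) :
    coeff n (bernoulliPowerSeries ℝ ^ k) = Bhigh k n / n.factorial := by
  rw [coeff_pow_eq_sum_antidiagonalTuple, Bhigh, Finset.sum_div]
  refine Finset.sum_congr rfl fun j hj => ?_
  have hspec := Nat.multinomial_spec Finset.univ j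
  rw [Finset.Nat.mem_antidiagonalTuple.mp hj] at hspec
  have hn : (n.factorial : ℝ) = (∏ i, ((j i).factorial : ℝ)) * Nat.multinomial Finset.univ j := by
    exact_mod_cast hspec.symm
  have hm : (Nat.multinomial Finset.univ j : ℝ) ≠ 0 := by
    intro h
    rw [h, mul_zero] at hn
    exact Nat.factorial_ne_zero n (by exact_mod_cast hn)
  have hp : (∏ i, ((j i).factorial : ℝ)) ≠ 0 :=
    Finset.prod_ne_zero_iff.mpr fun i _ => by positivity
  rw [hn]
  simp only [bernoulliPowerSeries, coeff_mk, map_div₀, eq_ratCast, map_natCast,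
    Finset.prod_div_distrib]
  field_simp

open PowerSeries in
lemma coeff_pow_eq_zero_of_lt {R : Type*} [CommRing R] {a : R⟦X⟧} (ha : constantCoeff a = 0)
    {n d : ℕ} (h : n < d) : coeff n (a ^ d) = 0 := by
  obtain ⟨b, rfl⟩ := X_dvd_iff.mpr ha
  rw [mul_pow, coeff_X_pow_mul', if_neg h.not_ge]

open PowerSeries in
lemma coeff_subst_eq_sum_range_s1 {R : Type*} [CommRing R] {a : R⟦X⟧} (ha : constantCoeff a = 0)
    (f : R⟦X⟧) (n : ℕ) :
    coeff n (f.subst a) = ∑ d ∈ Finset.range (n + 1), coeff d f * coeff n (a ^ d) := by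
  rw [coeff_subst' (HasSubst.of_constantCoeff_zero' ha),
    finsum_eq_sum_of_support_subset (s := Finset.range (n + 1))]
  · simp only [smul_eq_mul]
  · intro d hd
    by_contra h
    refine hd ?_
    simp only [Finset.coe_range, Set.mem_Iio, not_lt] at h
    simp [coeff_pow_eq_zero_of_lt ha (Nat.lt_of_succ_le h)]

open PowerSeries in
lemma sum_S2_mul_S2 (k m : ℕ) :
    ∑ l ∈ Finset.Icc k (m + k), S2 l k * S2 (m + k) l =
      ((m + k).factorial : ℝ) / k.factorial *
        coeff (m + k) (((exp ℝ - 1) ^ k).subst (exp ℝ - 1)) := by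
  have h0 : constantCoeff (exp ℝ - 1) = 0 := by simp
  have hsub : Finset.Icc k (m + k) ⊆ Finset.range (m + k + 1) := fun l hl => by
    simp only [Finset.mem_Icc, Finset.mem_range] at *
    omega
  rw [coeff_subst_eq_sum_range_s1 h0, ← Finset.sum_subset hsub, Finset.mul_sum]
  · refine Finset.sum_congr rfl fun l _ => ?_
    rw [coeff_exp_sub_one_pow, coeff_exp_sub_one_pow]
    field_simp
  · intro l hl hl'
    simp only [Finset.mem_Icc, Finset.mem_range] at *
    rw [coeff_pow_eq_zero_of_lt h0 (by omega), zero_mul]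

open PowerSeries in
lemma coeff_exp_sub_one_pow_eq_sum (k n : ℕ) :
    coeff n ((exp ℝ - 1) ^ k) =
      ∑ l ∈ (Finset.Nat.antidiagonalTuple k n).filter (fun l => ∀ i, 1 ≤ l i),
        1 / ∏ i, ((l i).factorial : ℝ) := by
  rw [coeff_pow_eq_sum_antidiagonalTuple, Finset.sum_filter]
  refine Finset.sum_congr rfl fun l _ => ?_
  split_ifs with h
  · rw [one_div, ← Finset.prod_inv_distrib]
    refine Finset.prod_congr rfl fun i _ => ?_
    have hi : l i ≠ 0 := Nat.one_le_iff_ne_zero.mp (h i)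
    simp [coeff_exp, coeff_one, hi]
  · push Not at h
    obtain ⟨i, hi⟩ := h
    refine Finset.prod_eq_zero (Finset.mem_univ i) ?_
    simp [Nat.lt_one_iff.mp hi]

open PowerSeries in
/-- Writing `e = exp - 1 = X * D`, the series `((exp - 1) ^ k) ∘ e`
divided by `X ^ k` and multiplied by `(X / e) ^ k` is `D ^ k ∘ e`. -/
lemma bernoulliPowerSeries_pow_mul_eq_subst {D : ℝ⟦X⟧} (hD : exp ℝ - 1 = X * D) (k : ℕ) :
    bernoulliPowerSeries ℝ ^ k * (mk fun m => coeff (m + k) (((exp ℝ - 1) ^ k).subst (exp ℝ - 1)))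
      = (D ^ k).subst (exp ℝ - 1) := by
  have hs : HasSubst (exp ℝ - 1) := HasSubst.of_constantCoeff_zero' (by simp)
  have hBD : bernoulliPowerSeries ℝ * D = 1 := by
    have h := bernoulliPowerSeries_mul_exp_sub_one ℝ
    rw [hD, mul_left_comm] at h
    exact mul_left_cancel₀ X_ne_zero (h.trans (mul_one X).symm)
  have hG : ((exp ℝ - 1) ^ k).subst (exp ℝ - 1) =
      X ^ k * (D ^ k * (D ^ k).subst (exp ℝ - 1)) := by
    conv_lhs => enter [2]; rw [hD]
    rw [mul_pow, subst_mul hs, subst_pow hs X, subst_X hs, ← mul_assoc, ← mul_pow, ← hD]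
  have hL : (mk fun m => coeff (m + k) (((exp ℝ - 1) ^ k).subst (exp ℝ - 1))) =
      D ^ k * (D ^ k).subst (exp ℝ - 1) := by
    ext m
    rw [coeff_mk, hG, coeff_X_pow_mul]
  rw [hL, ← mul_assoc, ← mul_pow, hBD, one_pow, one_mul]

/-- For `n ≥ 0`, `k ≥ 1`:
`∑_{m=0}^n ∑_{l=k}^{m+k} (C(n,m)/C(m+k,m)) S₂(l,k) S₂(m+k,l) B_{n−m}^{(k)}
  = ∑_{m=0}^n S₂(n,m) ∑_{l₁+⋯+l_k=m+k, lᵢ≥1} m!/(l₁!⋯l_k!)`. -/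
theorem stmt1 (n k : ℕ) (hk : 1 ≤ k) :
    ∑ m ∈ Finset.range (n + 1), ∑ l ∈ Finset.Icc k (m + k),
        ((n.choose m : ℝ) / ((m + k).choose m : ℝ)) * S2 l k * S2 (m + k) l * Bhigh k (n - m)
      = ∑ m ∈ Finset.range (n + 1), S2 n m *
          ∑ l ∈ (Finset.Nat.antidiagonalTuple k (m + k)).filter (fun l => ∀ i, 1 ≤ l i),
            (Nat.factorial m : ℝ) / ∏ i, (Nat.factorial (l i) : ℝ) := by
  have h0 : PowerSeries.constantCoeff (PowerSeries.exp ℝ - 1) = 0 := by simp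
  obtain ⟨D, hD⟩ := PowerSeries.X_dvd_iff.mpr h0
  have key := congrArg (fun f => (n.factorial : ℝ) * PowerSeries.coeff n f)
    (bernoulliPowerSeries_pow_mul_eq_subst hD k)
  rw [coeff_subst_eq_sum_range_s1 h0, mul_comm (bernoulliPowerSeries ℝ ^ k), PowerSeries.coeff_mul,
    Finset.Nat.sum_antidiagonal_eq_sum_range_succ_mk, Finset.mul_sum, Finset.mul_sum] at key
  refine Eq.trans (Finset.sum_congr rfl fun m hm => ?_)
    (key.trans (Finset.sum_congr rfl fun m _ => ?_))
  · have hmn : m ≤ n := Nat.lt_succ_iff.mp (Finset.mem_range.mp hm)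
    have hS := sum_S2_mul_S2 k m
    simp only [mul_assoc, ← Finset.mul_sum]
    simp only [← mul_assoc, ← Finset.sum_mul]
    rw [mul_assoc, hS, PowerSeries.coeff_mk, coeff_bernoulliPowerSeries_pow,
      Nat.cast_choose ℝ hmn, Nat.cast_choose ℝ (Nat.le_add_right m k), Nat.add_sub_cancel_left]
    field_simp
  · have hDk : PowerSeries.coeff m (D ^ k) =
        PowerSeries.coeff (m + k) ((PowerSeries.exp ℝ - 1) ^ k) := by
      rw [hD, mul_pow, PowerSeries.coeff_X_pow_mul]
    rw [hDk, coeff_exp_sub_one_pow_eq_sum, coeff_exp_sub_one_pow]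
    simp only [div_eq_mul_inv (m.factorial : ℝ) (∏ _, _), ← Finset.mul_sum, one_div]
    field_simp
end

section
/- Let X be the continuous random variable with density f(x) = ∫₀¹ e^{−x} x^{u−1}/Γ(u) du on (0,∞), i.e., a gamma random variable with rate 1 whose shape parameter is uniform on (0,1). Then for every integer n ≥ 1, E[Xⁿ] − n·E[X^{n−1}] = (−1)ⁿ b_n, i.e., ∫₀¹ ∫₀^∞ xⁿ e^{−x} x^{u−1}/Γ(u) dx du − n·∫₀¹ ∫₀^∞ x^{n−1} e^{−x} x^{u−1}/Γ(u) dx du = (−1)ⁿ b_n. -/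
open MeasureTheory Finset

/-- Bernoulli numbers of the second kind: `bₙ = ∫₀¹ x(x−1)⋯(x−n+1) dx`. -/
noncomputable def bernoulliSecond (n : ℕ) : ℝ :=
  ∫ x in (0 : ℝ)..1, ∏ i ∈ Finset.range n, (x - i)

/-- `Γ(u + n) = u (u + 1) ⋯ (u + n - 1) Γ(u)` for `u > 0`. -/
theorem gamma_add_natCast_eq_prod_mul {u : ℝ} (hu : 0 < u) (n : ℕ) :
    Real.Gamma (u + n) = (∏ i ∈ Finset.range n, (u + i)) * Real.Gamma u := by
  induction n with
  | zero => simp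
  | succ n ih =>
    have h : u + n ≠ 0 := by positivity
    rw [Nat.cast_succ, ← add_assoc, Real.Gamma_add_one h, ih, Finset.prod_range_succ]
    ring

/-- The `n`-th moment of the gamma distribution with rate `1` and shape `u` is the rising
factorial of `u`. -/
theorem integral_gamma_moment {u : ℝ} (hu : 0 < u) (n : ℕ) :
    ∫ x in Set.Ioi (0 : ℝ), x ^ n * Real.exp (-x) * x ^ (u - 1) / Real.Gamma u
      = ∏ i ∈ Finset.range n, (u + i) := by
  have hG : Real.Gamma u ≠ 0 := (Real.Gamma_pos_of_pos hu).ne'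
  rw [integral_div, div_eq_iff hG, ← gamma_add_natCast_eq_prod_mul hu n,
    Real.Gamma_eq_integral (by positivity)]
  refine setIntegral_congr_fun measurableSet_Ioi fun x (hx : 0 < x) => ?_
  rw [show u + n - 1 = n + (u - 1) by ring, Real.rpow_add hx, Real.rpow_natCast]
  ring

/-- The moment of order `n` of the gamma mixture with uniform shape. -/
theorem integral_gamma_mixture_moment (n : ℕ) :
    (∫ u in Set.Ioo (0 : ℝ) 1, ∫ x in Set.Ioi (0 : ℝ),
        x ^ n * Real.exp (-x) * x ^ (u - 1) / Real.Gamma u)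
      = ∫ u in (0 : ℝ)..1, ∏ i ∈ Finset.range n, (u + i) := by
  rw [intervalIntegral.integral_of_le zero_le_one, integral_Ioc_eq_integral_Ioo]
  exact setIntegral_congr_fun measurableSet_Ioo fun u hu => integral_gamma_moment hu.1 n

theorem prod_add_sub_mul_prod_add (u : ℝ) (m : ℕ) :
    (∏ i ∈ Finset.range (m + 1), (u + i)) - (m + 1) * ∏ i ∈ Finset.range m, (u + i)
      = (-1) ^ (m + 1) * ∏ i ∈ Finset.range (m + 1), (1 - u - i) := by
  have h : ∏ i ∈ Finset.range m, (1 - u - ((i + 1 : ℕ) : ℝ))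
      = (-1) ^ m * ∏ i ∈ Finset.range m, (u + i) := by
    rw [← Finset.card_range m, ← Finset.prod_const, Finset.card_range,
      ← Finset.prod_mul_distrib]
    refine Finset.prod_congr rfl fun i _ => ?_
    push_cast
    ring
  have hs : ((-1 : ℝ) ^ m) * (-1) ^ m = 1 := by rw [← mul_pow]; simp
  rw [Finset.prod_range_succ' (fun i : ℕ => 1 - u - (i : ℝ)), h, Finset.prod_range_succ]
  push_cast
  linear_combination (1 - u) * (∏ i ∈ Finset.range m, (u + i)) * hs

/-- Let `X` have density `f(x) = ∫₀¹ e^{−x} x^{u−1}/Γ(u) du` on `(0,∞)` (gamma with rate 1 and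
shape uniform on `(0,1)`).  Then for `n ≥ 1`, `E[Xⁿ] − n E[X^{n−1}] = (−1)ⁿ bₙ`. -/
theorem stmt3 (n : ℕ) (hn : 1 ≤ n) :
    (∫ u in Set.Ioo (0 : ℝ) 1, ∫ x in Set.Ioi (0 : ℝ),
        x ^ n * Real.exp (-x) * x ^ (u - 1) / Real.Gamma u)
      - n * ∫ u in Set.Ioo (0 : ℝ) 1, ∫ x in Set.Ioi (0 : ℝ),
          x ^ (n - 1) * Real.exp (-x) * x ^ (u - 1) / Real.Gamma u
      = (-1) ^ n * bernoulliSecond n := by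
  obtain ⟨m, rfl⟩ := Nat.exists_eq_add_of_le' hn
  have hint (k : ℕ) : IntervalIntegrable (fun u : ℝ => ∏ i ∈ Finset.range k, (u + i))
      volume 0 1 := by
    apply Continuous.intervalIntegrable
    fun_prop
  have hb : bernoulliSecond (m + 1)
      = ∫ u in (0 : ℝ)..1, ∏ i ∈ Finset.range (m + 1), (1 - u - i) := by
    rw [intervalIntegral.integral_comp_sub_left
      (fun x : ℝ => ∏ i ∈ Finset.range (m + 1), (x - i)) 1]
    simp [bernoulliSecond]
  rw [Nat.add_sub_cancel, integral_gamma_mixture_moment, integral_gamma_mixture_moment, hb,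
    ← intervalIntegral.integral_const_mul, ← intervalIntegral.integral_const_mul,
    ← intervalIntegral.integral_sub (hint _) ((hint _).const_mul _)]
  refine intervalIntegral.integral_congr fun u _ => ?_
  simpa using prod_add_sub_mul_prod_add u m
end

section
/- Let λ ∈ ℝ and let n ≥ k ≥ 0 be integers. Then S_{1,λ}(n,k) = (−λ)^{n−k} · C(n,k) · ∫_{(0,1)^k} ∫_{(0,∞)^k} (u₁x₁+⋯+u_kx_k)^{n−k} e^{−(x₁+⋯+x_k)} dx₁⋯dx_k du₁⋯du_k, where the integral is the (n−k)-th moment E[(U₁X₁+⋯+U_kX_k)^{n−k}] for independent uniform random variables U₁,…,U_k on (0,1) and independent gamma random variables X₁,…,X_k with density e^{−x} on (0,∞). -/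
open MeasureTheory Finset

/-- Degenerate Stirling numbers of the first kind: coefficients of
`x(x−λ)(x−2λ)⋯(x−(n−1)λ) = ∑_{k=0}^n S_{1,λ}(n,k) x^k`. -/
noncomputable def S1deg (lam : ℝ) (n k : ℕ) : ℝ :=
  (∏ i ∈ Finset.range n, (Polynomial.X - Polynomial.C ((i : ℝ) * lam))).coeff k

/-- The power series `log (1 - c t) / (-c t) = ∑ c ^ j t ^ j / (j + 1)`. -/
noncomputable def logQuotSeries (c : ℝ) : PowerSeries ℝ :=
  PowerSeries.mk fun j => c ^ j / ((j : ℝ) + 1)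

lemma derivative_X_mul_logQuotSeries (c : ℝ) :
    PowerSeries.derivative ℝ (PowerSeries.X * logQuotSeries c) = PowerSeries.mk fun j => c ^ j := by
  ext n
  rw [PowerSeries.coeff_derivative, PowerSeries.coeff_succ_X_mul, logQuotSeries,
    PowerSeries.coeff_mk, PowerSeries.coeff_mk]
  field_simp

lemma coeff_X_mul_derivative (f : PowerSeries ℝ) (n : ℕ) :
    PowerSeries.coeff n (PowerSeries.X * PowerSeries.derivative ℝ f) =
      n * PowerSeries.coeff n f := by
  cases n with
  | zero => simp
  | succ n =>
    rw [PowerSeries.coeff_succ_X_mul, PowerSeries.coeff_derivative]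
    push_cast
    ring

lemma one_sub_mul_geometric (c : ℝ) :
    (1 - PowerSeries.C c * PowerSeries.X) * (PowerSeries.mk fun j => c ^ j) = 1 := by
  ext n
  rw [sub_mul, one_mul, mul_assoc, map_sub, PowerSeries.coeff_C_mul, PowerSeries.coeff_mk]
  cases n with
  | zero => simp
  | succ n =>
    rw [PowerSeries.coeff_succ_X_mul, PowerSeries.coeff_mk, PowerSeries.coeff_one]
    simp [pow_succ']

lemma coeff_succ_X_mul_logQuotSeries_pow (c : ℝ) (n k : ℕ) :
    ((n : ℝ) + 1) * PowerSeries.coeff (n + 1) ((PowerSeries.X * logQuotSeries c) ^ (k + 1)) =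
      c * n * PowerSeries.coeff n ((PowerSeries.X * logQuotSeries c) ^ (k + 1)) +
        ((k : ℝ) + 1) * PowerSeries.coeff n ((PowerSeries.X * logQuotSeries c) ^ k) := by
  set G := PowerSeries.X * logQuotSeries c with hG
  have hD : (1 - PowerSeries.C c * PowerSeries.X) * PowerSeries.derivative ℝ (G ^ (k + 1)) =
      PowerSeries.C ((k : ℝ) + 1) * G ^ k := by
    rw [PowerSeries.derivative_pow, hG, derivative_X_mul_logQuotSeries, ← hG, mul_left_comm,
      one_sub_mul_geometric]
    simp
  have h := congrArg (PowerSeries.coeff n) hD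
  rw [sub_mul, one_mul, mul_assoc, map_sub, PowerSeries.coeff_C_mul, PowerSeries.coeff_C_mul,
    coeff_X_mul_derivative, PowerSeries.coeff_derivative] at h
  linarith

lemma S1deg_succ_zero (lam : ℝ) (n : ℕ) :
    S1deg lam (n + 1) 0 = -(n * lam) * S1deg lam n 0 := by
  rw [S1deg, S1deg, Finset.prod_range_succ, Polynomial.mul_coeff_zero]
  simp [mul_comm]

lemma S1deg_succ_succ (lam : ℝ) (n k : ℕ) :
    S1deg lam (n + 1) (k + 1) = S1deg lam n k - n * lam * S1deg lam n (k + 1) := by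
  rw [S1deg, S1deg, S1deg, Finset.prod_range_succ, mul_sub, Polynomial.coeff_sub,
    Polynomial.coeff_mul_X, Polynomial.coeff_mul_C]
  ring

/-- The exponential generating function of the degenerate Stirling numbers of the first kind. -/
lemma factorial_mul_S1deg (lam : ℝ) (n k : ℕ) :
    (k.factorial : ℝ) * S1deg lam n k =
      n.factorial * PowerSeries.coeff n ((PowerSeries.X * logQuotSeries (-lam)) ^ k) := by
  induction n generalizing k with
  | zero =>
    cases k with
    | zero => simp [S1deg]
    | succ k => simp [S1deg, Polynomial.coeff_one]
  | succ n ih =>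
    cases k with
    | zero =>
      have h := ih 0
      rw [S1deg_succ_zero]
      rcases n with _ | n
      · simp [PowerSeries.coeff_one]
      · simp [PowerSeries.coeff_one] at h ⊢
        simp [h]
    | succ k =>
      have h₀ := ih k
      have h₁ := ih (k + 1)
      have h := coeff_succ_X_mul_logQuotSeries_pow (-lam) n k
      rw [S1deg_succ_succ]
      rw [Nat.factorial_succ] at h₁ ⊢
      rw [Nat.factorial_succ]
      push_cast at h₁ ⊢
      linear_combination ((k : ℝ) + 1) * h₀ - n * lam * h₁ - n.factorial * h

lemma coeff_logQuotSeries_pow (c : ℝ) (k m : ℕ) :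
    PowerSeries.coeff m (logQuotSeries c ^ k) =
      c ^ m * ∑ j ∈ Finset.piAntidiag (Finset.univ : Finset (Fin k)) m,
        ∏ i, (1 / ((j i : ℝ) + 1)) := by
  have h : logQuotSeries c ^ k = ∏ _i : Fin k, logQuotSeries c := by simp
  rw [h, PowerSeries.coeff_prod, Finset.mul_sum]
  refine Finset.sum_bij (fun l _ => l) (fun l hl => ?_) (fun _ _ _ _ h => DFunLike.coe_injective h)
    (fun j hj => ⟨Finsupp.equivFunOnFinite.symm j, ?_, rfl⟩) (fun l hl => ?_)
  · simpa using (Finset.mem_finsuppAntidiag.1 hl).1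
  · simpa using hj
  · have hsum : ∑ i, l i = m := (Finset.mem_finsuppAntidiag.1 hl).1
    simp only [logQuotSeries, PowerSeries.coeff_mk]
    rw [← hsum, ← Finset.prod_pow_eq_pow_sum, ← Finset.prod_mul_distrib]
    simp [div_eq_mul_inv]

lemma integrableOn_pow_mul_exp_neg (n : ℕ) :
    IntegrableOn (fun x : ℝ => x ^ n * Real.exp (-x)) (Set.Ioi 0) := by
  have h := Real.GammaIntegral_convergent (s := (n : ℝ) + 1) (by positivity)
  simpa [mul_comm] using h

lemma integral_pow_mul_exp_neg (n : ℕ) :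
    ∫ x in Set.Ioi (0 : ℝ), x ^ n * Real.exp (-x) = n.factorial := by
  rw [← Real.Gamma_nat_eq_factorial, Real.Gamma_eq_integral (by positivity)]
  simp [mul_comm]

lemma integral_Ioo_zero_one_pow (n : ℕ) :
    ∫ u in Set.Ioo (0 : ℝ) 1, u ^ n = 1 / ((n : ℝ) + 1) := by
  rw [← integral_Ioc_eq_integral_Ioo, ← intervalIntegral.integral_of_le zero_le_one]
  simp

lemma integral_weighted_sum_pow_mul_exp_neg {k : ℕ} (m : ℕ) (u : Fin k → ℝ) :
    ∫ x in Set.univ.pi (fun _ : Fin k => Set.Ioi (0 : ℝ)),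
        (∑ i, u i * x i) ^ m * Real.exp (-∑ i, x i) =
      m.factorial * ∑ j ∈ Finset.piAntidiag (Finset.univ : Finset (Fin k)) m,
        ∏ i, u i ^ j i := by
  have hexpand (x : Fin k → ℝ) : (∑ i, u i * x i) ^ m * Real.exp (-∑ i, x i) =
      ∑ j ∈ Finset.piAntidiag (Finset.univ : Finset (Fin k)) m,
        (Nat.multinomial Finset.univ j * ∏ i, u i ^ j i) *
          ∏ i, (x i ^ j i * Real.exp (-x i)) := by
    rw [Finset.sum_pow_eq_sum_piAntidiag, Finset.sum_mul, ← Finset.sum_neg_distrib, Real.exp_sum]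
    refine Finset.sum_congr rfl fun j _ => ?_
    simp only [mul_pow, Finset.prod_mul_distrib]
    ring
  simp_rw [hexpand]
  rw [volume_pi, Measure.restrict_pi_pi, integral_finsetSum, Finset.mul_sum]
  · refine Finset.sum_congr rfl fun j hj => ?_
    have hsum : ∑ i, j i = m := (Finset.mem_piAntidiag.1 hj).1
    rw [integral_const_mul,
      integral_fintype_prod_eq_prod (fun i (y : ℝ) => y ^ j i * Real.exp (-y))]
    simp_rw [integral_pow_mul_exp_neg]
    rw [← hsum, ← Nat.multinomial_spec]
    push_cast
    ring
  · intro j _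
    exact (Integrable.fintype_prod_dep
      (f := fun i (y : ℝ) => y ^ j i * Real.exp (-y))
      fun i => integrableOn_pow_mul_exp_neg (j i)).const_mul _

lemma integral_unitCube_sum_prod_pow (k m : ℕ) :
    ∫ u in Set.univ.pi (fun _ : Fin k => Set.Ioo (0 : ℝ) 1),
        ∑ j ∈ Finset.piAntidiag (Finset.univ : Finset (Fin k)) m, ∏ i, u i ^ j i =
      ∑ j ∈ Finset.piAntidiag (Finset.univ : Finset (Fin k)) m, ∏ i, (1 / ((j i : ℝ) + 1)) := by
  rw [volume_pi, Measure.restrict_pi_pi, integral_finsetSum]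
  · refine Finset.sum_congr rfl fun j _ => ?_
    rw [integral_fintype_prod_eq_prod (fun i (y : ℝ) => y ^ j i)]
    simp_rw [integral_Ioo_zero_one_pow]
  · intro j _
    refine Integrable.fintype_prod_dep (f := fun i (y : ℝ) => y ^ j i) fun i => ?_
    exact ((continuous_pow (j i)).integrableOn_Icc (a := (0 : ℝ)) (b := 1)).mono_set
      Set.Ioo_subset_Icc_self

/-- For `n ≥ k ≥ 0`:
`S_{1,λ}(n,k) = (−λ)^{n−k} C(n,k) E[(U₁X₁+⋯+U_kX_k)^{n−k}]` where the `Uᵢ` are independent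
uniform on `(0,1)` and the `Xᵢ` independent gamma with density `e^{−x}` on `(0,∞)`. -/
theorem stmt4 (lam : ℝ) (n k : ℕ) (hkn : k ≤ n) :
    S1deg lam n k = (-lam) ^ (n - k) * (n.choose k : ℝ) *
      ∫ u in Set.univ.pi (fun _ : Fin k => Set.Ioo (0 : ℝ) 1),
        ∫ x in Set.univ.pi (fun _ : Fin k => Set.Ioi (0 : ℝ)),
          (∑ i, u i * x i) ^ (n - k) * Real.exp (-∑ i, x i) := by
  simp_rw [integral_weighted_sum_pow_mul_exp_neg]
  rw [integral_const_mul, integral_unitCube_sum_prod_pow]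
  have h := factorial_mul_S1deg lam n k
  rw [mul_pow, PowerSeries.coeff_X_pow_mul', if_pos hkn, coeff_logQuotSeries_pow,
    ← Nat.choose_mul_factorial_mul_factorial hkn] at h
  have hk : (k.factorial : ℝ) ≠ 0 := by positivity
  apply mul_left_cancel₀ hk
  rw [h]
  push_cast
  ring
end

section
/- Let λ ∈ ℝ and let n ≥ k ≥ 1 be integers. Then S_{2,λ}(n,k) = ∑_{m=k}^{n} C(m,k) · S_{1,λ}(n,m) · ∫_{(0,1)^k} (u₁+⋯+u_k)^{m−k} du₁⋯du_k, where the integral is the (m−k)-th moment E[(U₁+⋯+U_k)^{m−k}] of a sum of k independent uniform random variables on (0,1). -/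
open MeasureTheory Finset

/-- (Signed) Stirling numbers of the first kind. -/
noncomputable def S1 (n k : ℕ) : ℝ := S1deg 1 n k

/-- Degenerate Stirling numbers of the second kind:
`S_{2,λ}(n,k) = ∑_{m=k}^n λ^{n−m} S₁(n,m) S₂(m,k)`. -/
noncomputable def S2deg (lam : ℝ) (n k : ℕ) : ℝ :=
  ∑ m ∈ Finset.Icc k n, lam ^ (n - m) * S1 n m * S2 m k

/-- Scaling the roots: `S_{1,λ}(n,m) = λ^{n−m} S₁(n,m)`. -/
lemma S1deg_eq_pow_mul_S1 (lam : ℝ) (n m : ℕ) (h : m ≤ n) :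
    S1deg lam n m = lam ^ (n - m) * S1 n m := by
  unfold S1 S1deg
  have key : ∀ μ : ℝ, ∏ i ∈ Finset.range n, (Polynomial.X - Polynomial.C ((i : ℝ) * μ)) =
      (((Multiset.range n).map fun i : ℕ => (i : ℝ) * μ).map
        fun t => Polynomial.X - Polynomial.C t).prod := by
    intro μ
    rw [Multiset.map_map]
    rfl
  rw [key, key, Multiset.prod_X_sub_C_coeff _ (by simpa using h),
    Multiset.prod_X_sub_C_coeff _ (by simpa using h)]
  have hesymm : ∀ (s : Multiset ℝ) (j : ℕ),
      (s.map fun t => t * lam).esymm j = lam ^ j * s.esymm j := by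
    intro s j
    simp only [Multiset.esymm, Multiset.powersetCard_map, Multiset.map_map]
    rw [← Multiset.sum_map_mul_left]
    congr 1
    refine Multiset.map_congr rfl fun t ht => ?_
    have hcard : t.card = j := (Multiset.mem_powersetCard.1 ht).2
    simp [Multiset.prod_map_mul, Multiset.map_const', Multiset.prod_replicate, hcard, mul_comm (lam ^ j)]
  have hmap : ((Multiset.range n).map fun i : ℕ => (i : ℝ) * lam) =
      ((Multiset.range n).map fun i : ℕ => (i : ℝ) * 1).map fun t => t * lam := by
    simp
  rw [hmap, hesymm]
  simp only [Multiset.card_map, Multiset.card_range]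
  ring

/-- Continuous functions are integrable on the open unit cube. -/
lemma Continuous.integrable_pi_restrict_Ioo {k : ℕ} {f : (Fin k → ℝ) → ℝ} (hf : Continuous f) :
    Integrable f (Measure.pi fun _ : Fin k => volume.restrict (Set.Ioo (0 : ℝ) 1)) := by
  rw [← Measure.restrict_pi_pi]
  exact (hf.continuousOn.integrableOn_compact
    (isCompact_univ_pi fun _ : Fin k => isCompact_Icc (a := (0 : ℝ)) (b := 1))).mono_set
    (Set.pi_mono fun _ _ => Set.Ioo_subset_Icc_self)

/-- Integrating out one coordinate of a shifted moment over the unit cube. -/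
lemma integral_pi_add_sum_pow_succ (k p : ℕ) (x : ℝ) :
    ∫ u, (x + ∑ i, u i) ^ p
        ∂(Measure.pi fun _ : Fin (k + 1) => volume.restrict (Set.Ioo (0 : ℝ) 1)) =
      ((∫ u, (x + 1 + ∑ i, u i) ^ (p + 1)
          ∂(Measure.pi fun _ : Fin k => volume.restrict (Set.Ioo (0 : ℝ) 1))) -
        ∫ u, (x + ∑ i, u i) ^ (p + 1)
          ∂(Measure.pi fun _ : Fin k => volume.restrict (Set.Ioo (0 : ℝ) 1))) / (p + 1) := by
  have mp := (measurePreserving_piFinSuccAbove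
    (fun _ : Fin (k + 1) => volume.restrict (Set.Ioo (0 : ℝ) 1)) 0).symm
  have hint : Integrable (fun u : Fin (k + 1) → ℝ => (x + ∑ i, u i) ^ p)
      (Measure.pi fun _ => volume.restrict (Set.Ioo (0 : ℝ) 1)) :=
    Continuous.integrable_pi_restrict_Ioo (by fun_prop)
  have hint' : Integrable (fun z => (x + ∑ i, (MeasurableEquiv.piFinSuccAbove
      (fun _ : Fin (k + 1) => ℝ) 0).symm z i) ^ p) _ := (mp.integrable_comp_emb (MeasurableEquiv.measurableEmbedding _)).2 hint
  rw [← mp.integral_comp', integral_prod_symm _ hint',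
    ← integral_sub (Continuous.integrable_pi_restrict_Ioo (by fun_prop))
      (Continuous.integrable_pi_restrict_Ioo (by fun_prop)), ← integral_div]
  congr 1 with u
  have hinner : ∀ t : ℝ, (x + ∑ i, (MeasurableEquiv.piFinSuccAbove (fun _ => ℝ) 0).symm (t, u) i) ^ p
      = (t + (x + ∑ i, u i)) ^ p := by
    intro t
    simp [Fin.sum_univ_succ, MeasurableEquiv.piFinSuccAbove]
    ring
  simp only [hinner]
  rw [← integral_Ioc_eq_integral_Ioo, ← intervalIntegral.integral_of_le zero_le_one,
    intervalIntegral.integral_comp_add_right (fun t => t ^ p), integral_pow]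
  ring

/-- Moments of a shifted sum of uniform variables are iterated forward differences of powers. -/
lemma descFactorial_mul_integral_pi_add_sum_pow (k p : ℕ) (x : ℝ) :
    ((p + k).descFactorial k : ℝ) * ∫ u, (x + ∑ i, u i) ^ p
        ∂(Measure.pi fun _ : Fin k => volume.restrict (Set.Ioo (0 : ℝ) 1)) =
      (fwdDiff (1 : ℝ))^[k] (fun y => y ^ (p + k)) x := by
  induction k generalizing p x with
  | zero =>
    rw [Measure.pi_of_empty, integral_dirac]
    simp
  | succ k ih =>
    have hdesc : ((p + (k + 1)).descFactorial (k + 1) : ℝ) =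
        (p + 1) * ((p + 1 + k).descFactorial k : ℝ) := by
      rw [Nat.descFactorial_succ, show p + (k + 1) = p + 1 + k by ring, Nat.add_sub_cancel]
      push_cast
      ring
    rw [Function.iterate_succ_apply', fwdDiff, show p + (k + 1) = p + 1 + k by ring,
      ← ih, ← ih, integral_pi_add_sum_pow_succ, show p + 1 + k = p + (k + 1) by ring, hdesc,
      show p + (k + 1) = p + 1 + k by ring]
    have hp : (p + 1 : ℝ) ≠ 0 := by positivity
    field_simp

/-- `S₂(m,k) = C(m,k) E[(U₁+⋯+U_k)^{m−k}]`. -/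
lemma S2_eq_choose_mul_integral (m k : ℕ) (h : k ≤ m) :
    S2 m k = (m.choose k : ℝ) *
      ∫ u in Set.univ.pi (fun _ : Fin k => Set.Ioo (0 : ℝ) 1), (∑ i, u i) ^ (m - k) := by
  have hmain := descFactorial_mul_integral_pi_add_sum_pow k (m - k) 0
  rw [Nat.sub_add_cancel h, fwdDiff_iter_eq_sum_shift, Nat.descFactorial_eq_factorial_mul_choose]
    at hmain
  simp only [zero_add, nsmul_eq_mul, mul_one, zsmul_eq_mul] at hmain
  have hfac : (k.factorial : ℝ) ≠ 0 := by positivity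
  rw [volume_pi, Measure.restrict_pi_pi, S2, inv_mul_eq_iff_eq_mul₀ hfac, ← mul_assoc]
  push_cast at hmain
  exact hmain.symm

/-- For `n ≥ k ≥ 1`:
`S_{2,λ}(n,k) = ∑_{m=k}^n C(m,k) S_{1,λ}(n,m) E[(U₁+⋯+U_k)^{m−k}]`. -/
theorem stmt6 (lam : ℝ) (n k : ℕ) (hk : 1 ≤ k) (hkn : k ≤ n) :
    S2deg lam n k = ∑ m ∈ Finset.Icc k n, (m.choose k : ℝ) * S1deg lam n m *
      ∫ u in Set.univ.pi (fun _ : Fin k => Set.Ioo (0 : ℝ) 1), (∑ i, u i) ^ (m - k) := by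
  rw [S2deg]
  refine Finset.sum_congr rfl fun m hm => ?_
  obtain ⟨hkm, hmn⟩ := Finset.mem_Icc.1 hm
  rw [S2_eq_choose_mul_integral m k hkm, S1deg_eq_pow_mul_S1 lam n m hmn]
  ring
end

section
/- Let n ≥ k ≥ 1 be integers. Then (n/k) · ∫_{(0,1)^k} (u₁+⋯+u_k)^{n−k} du₁⋯du_k = ∫_{(0,1)^{k−1}} (u₁+⋯+u_{k−1}+1)^{n−k} du₁⋯du_{k−1}; probabilistically, (n/k)·E[(U₁+⋯+U_k)^{n−k}] = E[(U₁+⋯+U_{k−1}+1)^{n−k}] for independent uniform random variables U₁,…,U_k on (0,1). -/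
open MeasureTheory Finset

/-- A continuous function is integrable on the open unit cube. -/
theorem Continuous.integrable_pi_unitInterval {k : ℕ} {f : (Fin k → ℝ) → ℝ} (hf : Continuous f) :
    Integrable f (Measure.pi fun _ : Fin k => (volume : Measure ℝ).restrict (Set.Ioo 0 1)) := by
  rw [← Measure.restrict_pi_pi]
  change IntegrableOn f _ _
  have hc : IsCompact (Set.univ.pi fun _ : Fin k => Set.Icc (0 : ℝ) 1) :=
    isCompact_univ_pi fun _ => isCompact_Icc
  exact (hf.continuousOn.integrableOn_compact hc).mono_set
    (Set.pi_mono fun _ _ => Set.Ioo_subset_Icc_self)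

/-- The moments weighted by a coordinate do not depend on the coordinate. -/
theorem integral_coord_mul_sum_pow_pi {k : ℕ} (μ : Measure ℝ) [SigmaFinite μ] (i j : Fin k)
    (m : ℕ) :
    ∫ u, u i * (∑ l, u l) ^ m ∂(Measure.pi fun _ : Fin k => μ)
      = ∫ u, u j * (∑ l, u l) ^ m ∂(Measure.pi fun _ : Fin k => μ) := by
  have h := measurePreserving_piCongrLeft (fun _ : Fin k => μ) (Equiv.swap i j)
  rw [← h.integral_comp' (fun u => u j * (∑ l, u l) ^ m)]
  refine integral_congr_ae (.of_forall fun u => ?_)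
  have hu (l : Fin k) : MeasurableEquiv.piCongrLeft (fun _ : Fin k => ℝ) (Equiv.swap i j) u l
      = u (Equiv.swap i j l) := by
    obtain ⟨l, rfl⟩ := (Equiv.swap i j).surjective l
    rw [MeasurableEquiv.coe_piCongrLeft, Equiv.piCongrLeft_apply_apply (fun _ => ℝ)]
    simp
  simp only [hu, Equiv.swap_apply_right]
  rw [Equiv.sum_comp (Equiv.swap i j) u]

/-- `∫₀¹ ∂ₜ (t (t + s)ᵐ) dt = (1 + s)ᵐ`. -/
theorem setIntegral_add_pow_add_mul_pow (m : ℕ) (s : ℝ) :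
    ∫ t in Set.Ioo (0 : ℝ) 1, ((t + s) ^ m + m * (t * (t + s) ^ (m - 1))) = (s + 1) ^ m := by
  rw [← integral_Ioc_eq_integral_Ioo, ← intervalIntegral.integral_of_le zero_le_one,
    intervalIntegral.integral_eq_sub_of_hasDerivAt (f := fun t => t * (t + s) ^ m)]
  · ring
  · intro t _
    exact ((hasDerivAt_id' t).mul (((hasDerivAt_id' t).add_const s).pow m)).congr_deriv
      (by simp only [Pi.pow_apply]; ring)
  · exact Continuous.intervalIntegrable (by fun_prop) _ _

/-- For `n ≥ k ≥ 1`: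
`(n/k) E[(U₁+⋯+U_k)^{n−k}] = E[(U₁+⋯+U_{k−1}+1)^{n−k}]` for independent uniform random
variables on `(0,1)`. -/
theorem stmt8 (n k : ℕ) (hk : 1 ≤ k) (hkn : k ≤ n) :
    (n : ℝ) / k *
        ∫ u in Set.univ.pi (fun _ : Fin k => Set.Ioo (0 : ℝ) 1), (∑ i, u i) ^ (n - k)
      = ∫ u in Set.univ.pi (fun _ : Fin (k - 1) => Set.Ioo (0 : ℝ) 1),
          ((∑ i, u i) + 1) ^ (n - k) := by
  obtain ⟨k, rfl⟩ := Nat.exists_eq_add_of_le' hk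
  obtain ⟨m, rfl⟩ := Nat.exists_eq_add_of_le hkn
  simp only [Nat.add_sub_cancel_left, volume_pi, Measure.restrict_pi_pi]
  set μ : Measure ℝ := (volume : Measure ℝ).restrict (Set.Ioo 0 1)
  have hfubini : ∫ u, ((∑ i, u i) ^ m + m * (u 0 * (∑ i, u i) ^ (m - 1)))
      ∂(Measure.pi fun _ : Fin (k + 1) => μ)
      = ∫ u, ((∑ i, u i) + 1) ^ m ∂(Measure.pi fun _ : Fin k => μ) := by
    have hmp := (measurePreserving_piFinSuccAbove (fun _ : Fin (k + 1) => μ) 0).symm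
    have hint : Integrable
        (fun u : Fin (k + 1) → ℝ => (∑ i, u i) ^ m + m * (u 0 * (∑ i, u i) ^ (m - 1)))
        (Measure.pi fun _ => μ) :=
      Continuous.integrable_pi_unitInterval (by fun_prop)
    have hint' := (hmp.integrable_comp_emb (MeasurableEquiv.measurableEmbedding _)).2 hint
    refine (hmp.integral_comp' _).symm.trans ((integral_prod_symm _ hint').trans ?_)
    refine integral_congr_ae (.of_forall fun v => ?_)
    simpa [Fin.sum_univ_succ] using setIntegral_add_pow_add_mul_pow m (∑ i, v i)
  have hsymm : (m : ℝ) * ∫ u, (∑ i, u i) ^ m ∂(Measure.pi fun _ : Fin (k + 1) => μ)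
      = m * ((k + 1) * ∫ u, u 0 * (∑ i, u i) ^ (m - 1)
        ∂(Measure.pi fun _ : Fin (k + 1) => μ)) := by
    rcases m with _ | m
    · simp
    congr 1
    simp only [pow_succ', Finset.sum_mul, Nat.add_sub_cancel]
    rw [integral_finsetSum _ fun i _ => Continuous.integrable_pi_unitInterval (by fun_prop),
      Finset.sum_congr rfl fun i _ => integral_coord_mul_sum_pow_pi μ i 0 m]
    simp
  refine Eq.trans ?_ hfubini
  rw [integral_add (Continuous.integrable_pi_unitInterval (by fun_prop))
    (Continuous.integrable_pi_unitInterval (by fun_prop)), integral_const_mul]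
  have hk0 : (k : ℝ) + 1 ≠ 0 := by positivity
  push_cast
  field_simp
  linear_combination hsymm
end

section
/- Let X be a gamma random variable with density e^{−x} on (0,∞). Then for every integer n ≥ 0, E[(X−1)ⁿ] = d_n, i.e., ∫₀^∞ (x−1)ⁿ e^{−x} dx = d_n, where d_n is the n-th derangement number (the number of permutations of an n-element set with no fixed points). -/
open MeasureTheory Finset

open Filter Topology Asymptotics in
lemma tendsto_sub_one_pow_mul_exp_neg_atTop (n : ℕ) :
    Tendsto (fun x : ℝ => (x - 1) ^ n * Real.exp (-x)) atTop (𝓝 0) := by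
  have h := ((Real.tendsto_pow_mul_exp_neg_atTop_nhds_zero n).comp
    (tendsto_atTop_add_const_right atTop (-1 : ℝ) tendsto_id)).mul_const (Real.exp (-1))
  rw [zero_mul] at h
  refine h.congr fun x => ?_
  simp only [Function.comp_apply, id_eq, ← sub_eq_add_neg]
  rw [mul_assoc, ← Real.exp_add]
  ring_nf

open Filter Asymptotics in
lemma integrableOn_sub_one_pow_mul_exp_neg (n : ℕ) :
    IntegrableOn (fun x : ℝ => (x - 1) ^ n * Real.exp (-x)) (Set.Ioi 0) := by
  refine integrable_of_isBigO_exp_neg (b := 1 / 2) (by norm_num) (by fun_prop) ?_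
  have h := ((isLittleO_pow_exp_pos_mul_atTop n (b := 1 / 2) (by norm_num)).comp_tendsto
    (tendsto_atTop_add_const_right atTop (-1 : ℝ) tendsto_id)).isBigO.mul
    (isBigO_refl (fun x : ℝ => Real.exp (-x)) atTop)
  have h' : (fun x : ℝ => Real.exp (1 / 2 * (x + -1)) * Real.exp (-x)) =O[atTop]
      fun x => Real.exp (-(1 / 2) * x) := by
    refine ((isBigO_refl (fun x : ℝ => Real.exp (-(1 / 2) * x)) atTop).const_mul_left
      (Real.exp (-(1 / 2)))).congr_left fun x => ?_
    rw [← Real.exp_add, ← Real.exp_add]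
    ring_nf
  exact h.trans h'

lemma integral_sub_one_pow_succ_mul_exp_neg (n : ℕ) :
    ∫ x in Set.Ioi (0 : ℝ), (x - 1) ^ (n + 1) * Real.exp (-x) =
      (n + 1) * (∫ x in Set.Ioi (0 : ℝ), (x - 1) ^ n * Real.exp (-x)) - (-1) ^ n := by
  have hderiv : ∀ x ∈ Set.Ici (0 : ℝ),
      HasDerivAt (fun x : ℝ => -((x - 1) ^ (n + 1) * Real.exp (-x)))
        ((x - 1) ^ (n + 1) * Real.exp (-x) - (n + 1) * ((x - 1) ^ n * Real.exp (-x))) x := by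
    intro x _
    refine HasDerivAt.congr_deriv
      (((((hasDerivAt_id x).sub_const 1).pow (n + 1)).mul (hasDerivAt_neg x).exp).neg) ?_
    simp only [id_eq, Pi.pow_apply, Nat.add_sub_cancel]
    push_cast
    ring
  have hint := (integrableOn_sub_one_pow_mul_exp_neg n).const_mul (n + 1 : ℝ)
  have h := integral_Ioi_of_hasDerivAt_of_tendsto' hderiv
    ((integrableOn_sub_one_pow_mul_exp_neg (n + 1)).sub hint)
    (tendsto_sub_one_pow_mul_exp_neg_atTop (n + 1)).neg
  rw [integral_sub (integrableOn_sub_one_pow_mul_exp_neg (n + 1)) hint,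
    integral_const_mul] at h
  simp only [zero_sub, neg_zero, Real.exp_zero, mul_one, neg_neg, pow_succ (-1 : ℝ)] at h
  linarith

/-- For a gamma random variable `X` with density `e^{−x}` on `(0,∞)` and `n ≥ 0`:
`E[(X−1)ⁿ] = dₙ`, the `n`-th derangement number. -/
theorem stmt9 (n : ℕ) :
    ∫ x in Set.Ioi (0 : ℝ), (x - 1) ^ n * Real.exp (-x) = numDerangements n := by
  induction n with
  | zero => simp [integral_exp_Iic_zero]
  | succ n ih =>
    have h : (numDerangements (n + 1) : ℝ) = (n + 1) * numDerangements n - (-1) ^ n := by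
      exact_mod_cast numDerangements_succ n
    rw [integral_sub_one_pow_succ_mul_exp_neg, ih, h]
end

section
/- Let X be a gamma random variable with density e^{−x} on (0,∞) and let k ≥ 1 be an integer. Then for every integer n ≥ 0, E[(kX−1)ⁿ] = d_n(k), i.e., ∫₀^∞ (kx−1)ⁿ e^{−x} dx = d_n(k), where d_n(x) is the n-th derangement polynomial. -/
open MeasureTheory Finset

/-- Derangement polynomials: `d_n(x) = ∑_{j=0}^n (n!/(n−j)!) (−1)^{n−j} x^j`. -/
noncomputable def derPoly (n : ℕ) (x : ℝ) : ℝ :=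
  ∑ j ∈ Finset.range (n + 1), (n.descFactorial j : ℝ) * (-1 : ℝ) ^ (n - j) * x ^ j

theorem integrableOn_pow_mul_exp_neg_Ioi (j : ℕ) :
    IntegrableOn (fun x : ℝ => x ^ j * Real.exp (-x)) (Set.Ioi 0) := by
  simpa [mul_comm] using Real.GammaIntegral_convergent (s := j + 1) (by positivity)

theorem integral_pow_mul_exp_neg_Ioi (j : ℕ) :
    ∫ x in Set.Ioi (0 : ℝ), x ^ j * Real.exp (-x) = j.factorial := by
  rw [← Real.Gamma_nat_eq_factorial, Real.Gamma_eq_integral (by positivity)]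
  simp [mul_comm]

/-- For a gamma random variable `X` with density `e^{−x}` on `(0,∞)`, `k ≥ 1` and `n ≥ 0`:
`E[(kX−1)ⁿ] = dₙ(k)`, the `n`-th derangement polynomial at `k`. -/
theorem stmt10 (k : ℕ) (hk : 1 ≤ k) (n : ℕ) :
    ∫ x in Set.Ioi (0 : ℝ), (k * x - 1) ^ n * Real.exp (-x) = derPoly n k := by
  have expand (x : ℝ) : (k * x - 1) ^ n * Real.exp (-x) =
      ∑ j ∈ Finset.range (n + 1),
        ((k : ℝ) ^ j * (-1) ^ (n - j) * n.choose j) * (x ^ j * Real.exp (-x)) := by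
    rw [sub_eq_add_neg, add_pow, Finset.sum_mul]
    refine Finset.sum_congr rfl fun j _ => ?_
    ring
  simp_rw [expand]
  rw [integral_finsetSum _ fun j _ => (integrableOn_pow_mul_exp_neg_Ioi j).const_mul _, derPoly]
  refine Finset.sum_congr rfl fun j _ => ?_
  rw [integral_const_mul, integral_pow_mul_exp_neg_Ioi, Nat.descFactorial_eq_factorial_mul_choose]
  push_cast
  ring
end

section
/- For all integers n ≥ 0 and k ≥ 1, ∑_{l₁+⋯+l_k=n} (n choose l₁,…,l_k) d_{l₁}(1) d_{l₂}(2) ⋯ d_{l_k}(k) = ∑_{m=0}^{n} S₂(m+k,k) · m! · C(n,m) · (−1)^{n−m} · k^{n−m}. -/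
open MeasureTheory Finset

/-- The explicit formula `S2` satisfies the triangular recurrence of the Stirling numbers. -/
theorem S2_succ_succ (n k : ℕ) :
    S2 (n + 1) (k + 1) = ((k : ℝ) + 1) * S2 n (k + 1) + S2 n k := by
  have key : ∑ l ∈ range (k + 1 + 1),
      (-1 : ℝ) ^ (k + 1 - l) * ((k + 1).choose l) * (l : ℝ) ^ (n + 1) =
      ((k : ℝ) + 1) * ∑ l ∈ range (k + 1 + 1),
        (-1 : ℝ) ^ (k + 1 - l) * ((k + 1).choose l) * (l : ℝ) ^ n +
      ((k : ℝ) + 1) * ∑ l ∈ range (k + 1), (-1 : ℝ) ^ (k - l) * (k.choose l) * (l : ℝ) ^ n := by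
    rw [sum_range_succ, sum_range_succ _ (k + 1), mul_add, mul_sum, mul_sum, add_right_comm,
      ← sum_add_distrib]
    congr 1
    · refine sum_congr rfl fun l hl => ?_
      have hl : l ≤ k := by simpa [Nat.lt_succ_iff] using hl
      have h : (k.choose l : ℝ) * (k + 1) = (k + 1).choose l * (k + 1 - l) := by
        have := Nat.choose_mul_succ_eq k l
        rify [Nat.le_succ_of_le hl] at this
        simpa using this
      rw [Nat.succ_sub hl, pow_succ, pow_succ]
      linear_combination (-1 : ℝ) * (-1 : ℝ) ^ (k - l) * (l : ℝ) ^ n * h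
    · push_cast
      ring
  have hk : ((k : ℝ) + 1) ≠ 0 := by positivity
  have hf : (k.factorial : ℝ) ≠ 0 := by positivity
  rw [S2, key, S2, S2, Nat.factorial_succ]
  push_cast
  field_simp

theorem S2_eq_stirlingSecond (n k : ℕ) : S2 n k = Nat.stirlingSecond n k := by
  induction n generalizing k with
  | zero =>
    cases k with
    | zero => simp [S2]
    | succ k =>
      have h := add_pow (1 : ℝ) (-1) (k + 1)
      simp only [one_pow, one_mul, add_neg_cancel, ne_eq, Nat.succ_ne_zero, not_false_eq_true,
        zero_pow] at h
      simp [S2, ← h]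
  | succ n ih =>
    cases k with
    | zero => simp [S2]
    | succ k =>
      rw [S2_succ_succ, ih, ih, Nat.stirlingSecond_succ_succ]
      push_cast
      ring

namespace PowerSeries

theorem mk_pow_mul_one_sub {R : Type*} [CommRing R] (x : R) :
    (mk fun j => x ^ j) * (1 - C x * X) = 1 := by
  ext n
  cases n with
  | zero => simp [mul_sub]
  | succ n =>
    rw [mul_sub, mul_one, mul_left_comm, map_sub, coeff_C_mul, coeff_succ_mul_X]
    simp [coeff_one, pow_succ']

theorem mk_stirlingSecond_mul_one_sub {R : Type*} [CommRing R] (k : ℕ) :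
    (mk fun m => (Nat.stirlingSecond (m + (k + 1)) (k + 1) : R)) * (1 - C ((k : R) + 1) * X) =
      mk fun m => (Nat.stirlingSecond (m + k) k : R) := by
  ext n
  cases n with
  | zero => simp [mul_sub, Nat.stirlingSecond_self]
  | succ n =>
    rw [mul_sub, mul_one, mul_left_comm, map_sub, coeff_C_mul, coeff_succ_mul_X]
    simp only [coeff_mk]
    rw [← add_assoc, Nat.stirlingSecond_succ_succ, add_right_comm n 1 k, ← add_assoc n k 1]
    push_cast
    ring

/-- The generating function of the Stirling numbers of the second kind with fixed `k`. -/
theorem prod_mk_pow_eq_mk_stirlingSecond {R : Type*} [CommRing R] (k : ℕ) :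
    ∏ i : Fin k, (mk fun j => ((i.val : R) + 1) ^ j) =
      mk fun m => (Nat.stirlingSecond (m + k) k : R) := by
  induction k with
  | zero =>
    ext n
    cases n <;> simp [coeff_one]
  | succ k ih =>
    rw [Fin.prod_univ_castSucc]
    simp only [Fin.val_castSucc, Fin.val_last]
    rw [ih, ← mk_stirlingSecond_mul_one_sub, mul_assoc, mul_comm (1 - _), mk_pow_mul_one_sub,
      mul_one]

theorem coeff_prod_fin {R : Type*} [CommSemiring R] {k : ℕ} (f : Fin k → PowerSeries R) (n : ℕ) :
    coeff n (∏ i, f i) = ∑ l ∈ Finset.Nat.antidiagonalTuple k n, ∏ i, coeff (l i) (f i) := by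
  rw [coeff_prod]
  refine sum_equiv Finsupp.equivFunOnFinite (fun l => ?_) fun l _ => rfl
  simp [mem_finsuppAntidiag, Finset.Nat.mem_antidiagonalTuple]

/-- The exponential generating function of the derangement polynomials. -/
theorem mk_derPoly (x : ℝ) :
    (mk fun n => derPoly n x / n.factorial) = (mk fun j => x ^ j) * rescale (-1) (exp ℝ) := by
  ext n
  rw [coeff_mul, Finset.Nat.sum_antidiagonal_eq_sum_range_succ_mk, coeff_mk, derPoly, sum_div]
  refine sum_congr rfl fun j hj => ?_
  have h : ((n - j).factorial : ℝ) * n.descFactorial j = n.factorial := by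
    exact_mod_cast Nat.factorial_mul_descFactorial (Nat.lt_succ_iff.mp (mem_range.mp hj))
  have h₁ : (n.factorial : ℝ) ≠ 0 := by positivity
  have h₂ : ((n - j).factorial : ℝ) ≠ 0 := by positivity
  simp only [coeff_mk, coeff_rescale, coeff_exp, map_div₀, map_one, map_natCast]
  field_simp
  linear_combination x ^ j * h

theorem rescale_exp_pow {A : Type*} [CommRing A] [Algebra ℚ A] (a : A) (k : ℕ) :
    rescale a (exp A) ^ k = rescale (k * a) (exp A) := by
  rw [← map_pow, exp_pow_eq_rescale_exp, rescale_rescale]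

end PowerSeries

/-- For `n ≥ 0`, `k ≥ 1`:
`∑_{l₁+⋯+l_k=n} (n choose l₁,…,l_k) d_{l₁}(1)⋯d_{l_k}(k)
  = ∑_{m=0}^n S₂(m+k,k) m! C(n,m) (−1)^{n−m} k^{n−m}`. -/
theorem stmt13 (n k : ℕ) (hk : 1 ≤ k) :
    ∑ l ∈ Finset.Nat.antidiagonalTuple k n,
        (Nat.multinomial Finset.univ l : ℝ) * ∏ i, derPoly (l i) ((i.val : ℝ) + 1)
      = ∑ m ∈ Finset.range (n + 1),
          S2 (m + k) k * (Nat.factorial m : ℝ) * (n.choose m : ℝ) * (-1 : ℝ) ^ (n - m) *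
            (k : ℝ) ^ (n - m) := by
  have hprod : ∏ i : Fin k, (PowerSeries.mk fun n => derPoly n ((i.val : ℝ) + 1) / n.factorial) =
      (PowerSeries.mk fun m => (Nat.stirlingSecond (m + k) k : ℝ)) *
        PowerSeries.rescale ((k : ℝ) * -1) (PowerSeries.exp ℝ) := by
    simp only [PowerSeries.mk_derPoly]
    rw [prod_mul_distrib, PowerSeries.prod_mk_pow_eq_mk_stirlingSecond, prod_const, card_univ,
      Fintype.card_fin, PowerSeries.rescale_exp_pow]
  have hcoeff := congrArg (fun p => (n.factorial : ℝ) * PowerSeries.coeff n p) hprod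
  simp only [PowerSeries.coeff_prod_fin, PowerSeries.coeff_mul,
    Finset.Nat.sum_antidiagonal_eq_sum_range_succ_mk, mul_sum] at hcoeff
  convert hcoeff using 1
  · refine sum_congr rfl fun l hl => ?_
    have h : (∏ i, ((l i).factorial : ℝ)) * Nat.multinomial univ l = n.factorial := by
      rw [← Finset.Nat.mem_antidiagonalTuple.mp hl]
      exact_mod_cast Nat.multinomial_spec univ l
    have h₀ : (∏ i, ((l i).factorial : ℝ)) ≠ 0 :=
      prod_ne_zero_iff.mpr fun i _ => by positivity
    simp only [PowerSeries.coeff_mk, prod_div_distrib]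
    rw [← h]
    field_simp
  · refine sum_congr rfl fun m hm => ?_
    have h : ((n.choose m : ℝ) * m.factorial) * (n - m).factorial = n.factorial := by
      exact_mod_cast Nat.choose_mul_factorial_mul_factorial
        (Nat.lt_succ_iff.mp (mem_range.mp hm))
    have h₂ : ((n - m).factorial : ℝ) ≠ 0 := by positivity
    simp only [PowerSeries.coeff_mk, PowerSeries.coeff_rescale, PowerSeries.coeff_exp, map_div₀,
      map_one, map_natCast]
    rw [S2_eq_stirlingSecond, ← h, mul_pow]
    field_simp
end
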